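/- Let M be a free ℤ-module of finite rank equipped with a nondegenerate symmetric bilinear form B : M × M → ℤ. Let S ⊆ M be a submodule and T = {x ∈ M : B(x, s) = 0 for all s ∈ S} its orthogonal complement. Assume that S ⊕ T has finite index in M, i.e. for every m ∈ M there exist an integer n ≥ 1, s ∈ S and t ∈ T with n·m = s + t. Let φ_S be a ℤ-linear automorphism of S with B(φ_S s, φ_S s') = B(s, s') for all s, s' ∈ S, and let φ_T be a ℤ-linear automorphism of T with B(φ_T t, φ_T t') = B(t, t') for all t, t' ∈ T. Then the following are equivalent: (i) there exists a ℤ-linear automorphism ψ of M with B(ψ m, ψ m') = B(m, m') for all m, m' ∈ M, ψ(s) = φ_S(s) for all s ∈ S, and ψ(t) = φ_T(t) for all t ∈ T; (ii) for every m ∈ M, every integer n ≥ 1, every s ∈ S and t ∈ T with n·m = s + t, there exists m' ∈ M with n·m' = φ_S(s) + φ_T(t). -/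

import Mathlib

/-- Lemma 2.2 of the paper: an isometry `(φ_S, φ_T)` of `S ⊕ T` extends to an isometry of the
full lattice `M` if and only if it preserves the glue group `M/(S ⊕ T)`, here expressed
concretely via denominators. -/
theorem glue_isometry_iff
    (M : Type*) [AddCommGroup M] [Module ℤ M] [Module.Free ℤ M] [Module.Finite ℤ M]
    (B : M →ₗ[ℤ] M →ₗ[ℤ] ℤ)
    (hsymm : ∀ x y : M, B x y = B y x)
    (hnondeg : ∀ x : M, (∀ y : M, B x y = 0) → x = 0)
    (S T : Submodule ℤ M)
    (hT : ∀ x : M, x ∈ T ↔ ∀ s ∈ S, B x s = 0)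
    (hindex : ∀ m : M, ∃ (n : ℤ) (s t : M), 1 ≤ n ∧ s ∈ S ∧ t ∈ T ∧ n • m = s + t)
    (φS : S ≃ₗ[ℤ] S)
    (hφS : ∀ s s' : S, B (φS s : M) (φS s' : M) = B (s : M) (s' : M))
    (φT : T ≃ₗ[ℤ] T)
    (hφT : ∀ t t' : T, B (φT t : M) (φT t' : M) = B (t : M) (t' : M)) :
    (∃ ψ : M ≃ₗ[ℤ] M,
        (∀ m m' : M, B (ψ m) (ψ m') = B m m') ∧
        (∀ s : S, ψ (s : M) = (φS s : M)) ∧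
        (∀ t : T, ψ (t : M) = (φT t : M)))
    ↔
    (∀ (m : M) (n : ℤ), 1 ≤ n → ∀ (s : S) (t : T), n • m = (s : M) + (t : M) →
        ∃ m' : M, n • m' = (φS s : M) + (φT t : M)) := by
  obtain rfl : ‹Module ℤ M› = AddCommGroup.toIntModule M := Subsingleton.elim _ _
  have hcancel : ∀ (n : ℤ), 1 ≤ n → ∀ x : M, n • x = 0 → x = 0 := by
    intro n hn x hx
    rcases smul_eq_zero.mp hx with h | h
    · omega
    · exact h
  constructor
  · rintro ⟨ψ, -, h2, h3⟩ m n hn s t h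
    refine ⟨ψ m, ?_⟩
    rw [← map_smul, h, map_add, h2, h3]
  intro hii
  have hdisj : ∀ x : M, x ∈ S → x ∈ T → x = 0 := by
    intro x hxS hxT
    apply hnondeg
    intro y
    obtain ⟨n, s, t, hn, hs, ht, h⟩ := hindex y
    have h1 : n * B x y = 0 := by
      have h2 : B x (n • y) = n * B x y := by rw [map_smul, smul_eq_mul]
      rw [← h2, h, map_add, (hT x).1 hxT s hs, hsymm x t, (hT t).1 ht x hxS, add_zero]
    rcases mul_eq_zero.mp h1 with h | h
    · omega
    · exact h
  have hex : ∀ m : M, ∃ m' : M, ∃ n : ℤ, 1 ≤ n ∧ ∃ (s : S) (t : T),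
      n • m = (s : M) + t ∧ n • m' = (φS s : M) + φT t := by
    intro m
    obtain ⟨n, s, t, hn, hs, ht, h⟩ := hindex m
    obtain ⟨m', hm'⟩ := hii m n hn ⟨s, hs⟩ ⟨t, ht⟩ h
    exact ⟨m', n, hn, ⟨s, hs⟩, ⟨t, ht⟩, h, hm'⟩
  choose f hf using hex
  have hzero : ∀ (s : S) (t : T), (s : M) + t = 0 → (φS s : M) + φT t = 0 := by
    intro s t h
    have hs : (s : M) = 0 := by
      apply hdisj _ s.2
      rw [eq_neg_of_add_eq_zero_left h]
      exact T.neg_mem t.2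
    have ht : (t : M) = 0 := by rwa [hs, zero_add] at h
    have hs' : s = 0 := Subtype.ext hs
    have ht' : t = 0 := Subtype.ext ht
    subst hs' ht'
    simp
  -- uniqueness
  have huniq : ∀ (m m' : M) (n : ℤ), 1 ≤ n → ∀ (s : S) (t : T),
      n • m = (s : M) + t → n • m' = (φS s : M) + φT t → f m = m' := by
    intro m m' n hn s t h h'
    obtain ⟨k, hk, u, v, e, e'⟩ := hf m
    have hnk : 1 ≤ n * k := by nlinarith
    rw [← sub_eq_zero]
    apply hcancel (n * k) hnk
    have h0 := hzero (n • u - k • s) (n • v - k • t) (by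
      have : n • ((u : M) + v) - k • ((s : M) + t) = 0 := by
        rw [← e, ← h, smul_smul, smul_smul, mul_comm, sub_self]
      rw [← this]; push_cast; module)
    have : (n * k) • (f m - m') = n • (k • f m) - k • (n • m') := by module
    rw [this, e', h', ← h0]
    simp only [map_sub, map_smul]
    push_cast; module
  let F : M →ₗ[ℤ] M :=
    { toFun := f
      map_add' := by
        intro a b
        obtain ⟨k, hk, u, v, e, e'⟩ := hf a
        obtain ⟨n, hn, s, t, h, h'⟩ := hf b
        refine huniq _ _ (n * k) (by nlinarith) (n • u + k • s) (n • v + k • t) ?_ ?_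
        · have : (n * k) • (a + b) = n • (k • a) + k • (n • b) := by module
          rw [this, e, h]; push_cast; module
        · have : (n * k) • (f a + f b) = n • (k • f a) + k • (n • f b) := by module
          rw [this, e', h']; simp only [map_add, map_smul]; push_cast; module
      map_smul' := by
        intro c a
        obtain ⟨k, hk, u, v, e, e'⟩ := hf a
        refine huniq _ _ k hk (c • u) (c • v) ?_ ?_
        · rw [smul_comm, e]; push_cast; module
        · simp only [RingHom.id_apply]
          rw [smul_comm, e']; simp only [map_smul]; push_cast; module }
  have hFS : ∀ s : S, F (s : M) = φS s := fun s =>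
    huniq _ _ 1 le_rfl s 0 (by simp) (by simp)
  have hFT : ∀ t : T, F (t : M) = φT t := fun t =>
    huniq _ _ 1 le_rfl 0 t (by simp) (by simp)
  have horth : ∀ (s : S) (t : T), B (t : M) (s : M) = 0 := fun s t => (hT t).1 t.2 s s.2
  have horth' : ∀ (s : S) (t : T), B (s : M) (t : M) = 0 := fun s t => by
    rw [hsymm]; exact horth s t
  have hiso : ∀ a b : M, B (F a) (F b) = B a b := by
    intro a b
    obtain ⟨k, hk, u, v, e, e'⟩ := hf a
    obtain ⟨n, hn, s, t, h, h'⟩ := hf b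
    have hB : ∀ x y : M, B (k • x) (n • y) = (k * n) * B x y := by
      intro x y
      rw [map_smul, map_smul, LinearMap.smul_apply, smul_eq_mul, smul_eq_mul]; ring
    have hkn : k * n ≠ 0 := by positivity
    apply mul_left_cancel₀ hkn
    rw [← hB, ← hB, e, h]
    change B (k • f a) (n • f b) = _
    rw [e', h']
    simp only [map_add, LinearMap.add_apply, horth, horth', hφS, hφT]
  have hinj : Function.Injective F := by
    rw [injective_iff_map_eq_zero]
    intro a ha
    apply hnondeg
    intro y
    rw [← hiso, ha, map_zero, LinearMap.zero_apply]
  -- surjectivity through the finite quotient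
  have hN : S ⊔ T ≤ (S ⊔ T).comap F := by
    rw [sup_le_iff]
    constructor
    · intro s hs
      rw [Submodule.mem_comap, hFS ⟨s, hs⟩]
      exact Submodule.mem_sup_left (φS _).2
    · intro s hs
      rw [Submodule.mem_comap, hFT ⟨s, hs⟩]
      exact Submodule.mem_sup_right (φT _).2
  have hNr : ∀ x ∈ S ⊔ T, ∃ y ∈ S ⊔ T, F y = x := by
    intro x hx
    obtain ⟨s, hs, t, ht, rfl⟩ := Submodule.mem_sup.1 hx
    refine ⟨(φS.symm ⟨s, hs⟩ : M) + φT.symm ⟨t, ht⟩,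
      Submodule.add_mem_sup (φS.symm _).2 (φT.symm _).2, ?_⟩
    rw [map_add, hFS, hFT]; simp
  have hfin : Finite (M ⧸ (S ⊔ T)) := by
    apply Module.finite_of_fg_torsion
    intro x
    obtain ⟨m, rfl⟩ := Submodule.Quotient.mk_surjective _ x
    obtain ⟨n, s, t, hn, hs, ht, h⟩ := hindex m
    refine ⟨⟨n, mem_nonZeroDivisors_of_ne_zero (by omega)⟩, ?_⟩
    change n • (Submodule.Quotient.mk m : M ⧸ (S ⊔ T)) = 0
    rw [← Submodule.Quotient.mk_smul, Submodule.Quotient.mk_eq_zero, h]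
    exact Submodule.add_mem_sup hs ht
  have hqinj : Function.Injective ((S ⊔ T).mapQ (S ⊔ T) F hN) := by
    rw [injective_iff_map_eq_zero]
    intro x hx
    obtain ⟨m, rfl⟩ := Submodule.Quotient.mk_surjective _ x
    rw [Submodule.mapQ_apply, Submodule.Quotient.mk_eq_zero] at hx
    obtain ⟨y, hy, hyx⟩ := hNr _ hx
    rw [Submodule.Quotient.mk_eq_zero, ← hinj hyx]
    exact hy
  have hqsurj := Finite.surjective_of_injective hqinj
  have hsurj : Function.Surjective F := by
    intro m
    obtain ⟨x, hx⟩ := hqsurj (Submodule.Quotient.mk m)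
    obtain ⟨a, rfl⟩ := Submodule.Quotient.mk_surjective _ x
    rw [Submodule.mapQ_apply, eq_comm, Submodule.Quotient.eq] at hx
    obtain ⟨y, -, hy⟩ := hNr _ hx
    exact ⟨y + a, by rw [map_add, hy, sub_add_cancel]⟩
  exact ⟨LinearEquiv.ofBijective F ⟨hinj, hsurj⟩, hiso, hFS, hFT⟩
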